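/- Let N ≥ 1 and ρ₀, …, ρ_{N−1} > 0. Suppose u₀, …, u_{N−1} with u_j : [0, ∞) × [j, j+1] → ℝ twice continuously differentiable satisfy, for all t > 0: the wave equations ∂ₜ²u_j(t, x) = ρ_j·∂ₓ²u_j(t, x) on [j, j+1]; the boundary conditions ρ₀·∂ₓu₀(t, 0) = ∂ₜu₀(t, 0) and u_{N−1}(t, N) = 0; the continuity conditions u_{j−1}(t, j) = u_j(t, j) for j = 1, …, N−1; and the flux conditions ρ_{j−1}·∂ₓu_{j−1}(t, j) = ρ_j·∂ₓu_j(t, j) for j = 1, …, N−1. Define the energy E(t) = (1/2)·Σ_{j=0}^{N−1} ∫_j^{j+1} ( |∂ₜu_j(t, x)|² + ρ_j·|∂ₓu_j(t, x)|² ) dx. Then for every t > 0, E is differentiable at t and E'(t) = −|∂ₜu₀(t, 0)|². In particular E is nonincreasing. -/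

import Mathlib

open Set

/-- The energy `E(t) = (1/2) Σ_j ∫_j^{j+1} (|∂ₜu_j(t,x)|² + ρ_j |∂ₓu_j(t,x)|²) dx` of a chain
of `N` serially connected strings, where the spatial derivative on string `j` is taken within
`[j, j+1]`. -/
noncomputable def chainWaveEnergy (N : ℕ) (ρ : ℕ → ℝ) (u : ℕ → ℝ → ℝ → ℝ) (t : ℝ) : ℝ :=
  (1 / 2) * ∑ j ∈ Finset.range N, ∫ x in (j : ℝ)..(j + 1),
    ((deriv (fun s => u j s x) t) ^ 2 +
      ρ j * (derivWithin (fun y => u j t y) (Icc (j : ℝ) (j + 1)) x) ^ 2)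

open Topology MeasureTheory in
lemma aux_t {E : Type*} [NormedAddCommGroup E] [NormedSpace ℝ E] {a b : ℝ} {G : ℝ × ℝ → E}
    (hG : DifferentiableOn ℝ G (Ici (0 : ℝ) ×ˢ Icc a b)) {t x : ℝ} (ht : 0 < t)
    (hx : x ∈ Icc a b) :
    HasDerivAt (fun s => G (s, x))
      (fderivWithin ℝ G (Ici (0 : ℝ) ×ˢ Icc a b) (t, x) (1, 0)) t := by
  have h := (hG (t, x) ⟨ht.le, hx⟩).hasFDerivWithinAt
  have h2 : HasDerivWithinAt (fun s : ℝ => (s, x)) ((1 : ℝ), (0 : ℝ)) (Ici 0) t :=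
    ((hasDerivAt_id t).prodMk (hasDerivAt_const t x)).hasDerivWithinAt
  have h3 := HasFDerivWithinAt.comp_hasDerivWithinAt t h h2
    (fun s hs => mk_mem_prod hs hx)
  exact h3.hasDerivAt (Ici_mem_nhds ht)

lemma aux_x {E : Type*} [NormedAddCommGroup E] [NormedSpace ℝ E] {a b : ℝ} {G : ℝ × ℝ → E}
    (hG : DifferentiableOn ℝ G (Ici (0 : ℝ) ×ˢ Icc a b)) {t x : ℝ} (ht : 0 < t)
    (hx : x ∈ Icc a b) :
    HasDerivWithinAt (fun y => G (t, y))
      (fderivWithin ℝ G (Ici (0 : ℝ) ×ˢ Icc a b) (t, x) (0, 1)) (Icc a b) x := by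
  have h := (hG (t, x) ⟨ht.le, hx⟩).hasFDerivWithinAt
  have h2 : HasDerivWithinAt (fun y : ℝ => (t, y)) ((0 : ℝ), (1 : ℝ)) (Icc a b) x :=
    ((hasDerivAt_const x t).prodMk (hasDerivAt_id x)).hasDerivWithinAt
  exact HasFDerivWithinAt.comp_hasDerivWithinAt x h h2 (fun s hs => ⟨ht.le, hs⟩)

open Topology MeasureTheory in
lemma string_energy {a b r : ℝ} (hab : a < b) (u : ℝ → ℝ → ℝ)
    (hreg : ContDiffOn ℝ 2 (fun p : ℝ × ℝ => u p.1 p.2) (Ici (0 : ℝ) ×ˢ Icc a b))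
    (hwave : ∀ t > (0 : ℝ), ∀ x ∈ Icc a b,
      deriv (fun s => deriv (fun s' => u s' x) s) t =
        r * derivWithin (fun y => derivWithin (fun y' => u t y') (Icc a b) y) (Icc a b) x)
    {t : ℝ} (ht : 0 < t) :
    HasDerivAt (fun t => ∫ x in a..b, ((deriv (fun s => u s x) t) ^ 2 +
      r * (derivWithin (fun y => u t y) (Icc a b) x) ^ 2))
      (2 * (r * derivWithin (fun y => u t y) (Icc a b) b * deriv (fun s => u s b) t
        - r * derivWithin (fun y => u t y) (Icc a b) a * deriv (fun s => u s a) t)) t := by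
  set K := Ici (0 : ℝ) ×ˢ Icc a b with hK
  set F : ℝ × ℝ → ℝ := fun p => u p.1 p.2 with hF
  have hconv : Convex ℝ K := (convex_Ici 0).prod (convex_Icc a b)
  have hint : (interior K).Nonempty := by
    rw [hK, interior_prod_eq, interior_Ici, interior_Icc]
    exact ⟨(1, (a + b) / 2), by simp, by constructor <;> simp <;> linarith⟩
  have hU : UniqueDiffOn ℝ K := uniqueDiffOn_convex hconv hint
  have hUI : UniqueDiffOn ℝ (Icc a b) := uniqueDiffOn_Icc hab
  set D := fderivWithin ℝ F K with hD
  have hDc : ContDiffOn ℝ 1 D K := hreg.fderivWithin hU (by norm_num)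
  set D2 := fderivWithin ℝ D K with hD2
  have hD2c : ContinuousOn D2 K := hDc.continuousOn_fderivWithin hU (by norm_num)
  have hFd : DifferentiableOn ℝ F K := hreg.differentiableOn (by norm_num)
  have hDd : DifferentiableOn ℝ D K := hDc.differentiableOn (by norm_num)
  have hsymm : ∀ p ∈ K, ∀ v w, D2 p v w = D2 p w v := by
    intro p hp
    refine (hreg p hp).isSymmSndFDerivWithinAt (by simp) hU ?_ hp
    rw [hconv.closure_interior_eq_closure_of_nonempty_interior hint]
    exact subset_closure hp
  -- first derivatives
  have e1 : ∀ s > 0, ∀ x ∈ Icc a b, deriv (fun s => u s x) s = D (s, x) (1, 0) :=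
    fun s hs x hx => (aux_t hFd hs hx).deriv
  have e2 : ∀ s > 0, ∀ x ∈ Icc a b, derivWithin (fun y => u s y) (Icc a b) x = D (s, x) (0, 1) :=
    fun s hs x hx => (aux_x hFd hs hx).derivWithin (hUI x hx)
  have dt : ∀ s > 0, ∀ x ∈ Icc a b, ∀ z, HasDerivAt (fun s => D (s, x) z) (D2 (s, x) (1, 0) z) s :=
    fun s hs x hx z => by
      simpa using (aux_t hDd hs hx).clm_apply (hasDerivAt_const s z)
  have dx : ∀ s > 0, ∀ x ∈ Icc a b, ∀ z,
      HasDerivWithinAt (fun y => D (s, y) z) (D2 (s, x) (0, 1) z) (Icc a b) x :=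
    fun s hs x hx z => by
      simpa using (aux_x hDd hs hx).clm_apply (hasDerivWithinAt_const x (Icc a b) z)
  have hw : ∀ s > 0, ∀ x ∈ Icc a b, D2 (s, x) (1, 0) (1, 0) = r * D2 (s, x) (0, 1) (0, 1) := by
    intro s hs x hx
    have h := hwave s hs x hx
    have h1 : deriv (fun s => deriv (fun s' => u s' x) s) s = D2 (s, x) (1, 0) (1, 0) := by
      rw [← (dt s hs x hx (1, 0)).deriv]
      apply Filter.EventuallyEq.deriv_eq
      filter_upwards [Ioi_mem_nhds hs] with s' hs'
      exact e1 s' hs' x hx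
    have h2 : derivWithin (fun y => derivWithin (fun y' => u s y') (Icc a b) y) (Icc a b) x
        = D2 (s, x) (0, 1) (0, 1) := by
      rw [← (dx s hs x hx (0, 1)).derivWithin (hUI x hx)]
      exact derivWithin_congr (fun y hy => e2 s hs y hy) (e2 s hs x hx)
    rw [← h1, ← h2, h]
  have cx : ∀ s > 0, MapsTo (fun x : ℝ => (s, x)) (Icc a b) K := fun s hs x hx => ⟨hs.le, hx⟩
  have cD : ∀ z, ContinuousOn (fun p => D p z) K :=
    fun z => hDc.continuousOn.clm_apply continuousOn_const
  have cD2 : ∀ z z', ContinuousOn (fun p => D2 p z z') K :=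
    fun z z' => (hD2c.clm_apply continuousOn_const).clm_apply continuousOn_const
  let Φ : ℝ × ℝ → ℝ := fun p => D p (1, 0) ^ 2 + r * D p (0, 1) ^ 2
  let Φ' : ℝ × ℝ → ℝ := fun p => 2 * D p (1, 0) * D2 p (1, 0) (1, 0)
    + r * (2 * D p (0, 1) * D2 p (1, 0) (0, 1))
  have cΦ : ContinuousOn Φ K := ((cD _).pow 2).add (continuousOn_const.mul ((cD _).pow 2))
  have cΦ' : ContinuousOn Φ' K :=
    ((continuousOn_const.mul (cD _)).mul (cD2 _ _)).add
      (continuousOn_const.mul ((continuousOn_const.mul (cD _)).mul (cD2 _ _)))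
  have slice : ∀ {Ψ : ℝ × ℝ → ℝ}, ContinuousOn Ψ K → ∀ s > 0,
      ContinuousOn (fun x => Ψ (s, x)) (Icc a b) := fun h s hs =>
    h.comp (by fun_prop) (cx s hs)
  have sliceI : ∀ {Ψ : ℝ × ℝ → ℝ}, ContinuousOn Ψ K → ∀ s > 0,
      IntervalIntegrable (fun x => Ψ (s, x)) volume a b := fun h s hs =>
    ContinuousOn.intervalIntegrable (by rw [uIcc_of_le hab.le]; exact slice h s hs)
  have hcomp : IsCompact (Icc (t / 2) (2 * t) ×ˢ Icc a b) := isCompact_Icc.prod isCompact_Icc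
  obtain ⟨C, hC⟩ := hcomp.exists_bound_of_continuousOn
    (cΦ'.mono (prod_mono (fun s hs => (by have := hs.1; simp; linarith)) subset_rfl))
  have hsub : uIoc a b ⊆ Icc a b := by rw [uIoc_of_le hab.le]; exact Ioc_subset_Icc_self
  have key := (intervalIntegral.hasDerivAt_integral_of_dominated_loc_of_deriv_le
    (μ := volume) (a := a) (b := b) (F := fun s x => Φ (s, x)) (F' := fun s x => Φ' (s, x))
    (x₀ := t) (s := Icc (t / 2) (2 * t)) (bound := fun _ => C)
    (Icc_mem_nhds (by linarith) (by linarith))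
    (by
      filter_upwards [Ioi_mem_nhds ht] with s hs
      exact (intervalIntegrable_iff.1 (sliceI cΦ s hs)).aestronglyMeasurable)
    (sliceI cΦ t ht)
    (intervalIntegrable_iff.1 (sliceI cΦ' t ht)).aestronglyMeasurable
    (Filter.Eventually.of_forall fun x hx s hs => hC (s, x) ⟨hs, hsub hx⟩)
    intervalIntegrable_const
    (Filter.Eventually.of_forall fun x hx s hs => by
      have hs0 : 0 < s := by have := hs.1; linarith
      have h1 := (dt s hs0 x (hsub hx) (1, 0)).pow 2
      have h2 := ((dt s hs0 x (hsub hx) (0, 1)).pow 2).const_mul r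
      refine HasDerivAt.congr_deriv (f := fun s => Φ (s, x)) (h1.add h2) ?_
      simp [Φ'])).2
  have hval : ∫ x in a..b, Φ' (t, x) =
      2 * r * D (t, b) (0, 1) * D (t, b) (1, 0) - 2 * r * D (t, a) (0, 1) * D (t, a) (1, 0) := by
    refine intervalIntegral.integral_eq_sub_of_hasDerivAt_of_le
      (f := fun x => 2 * r * D (t, x) (0, 1) * D (t, x) (1, 0)) hab.le ?_ ?_ (sliceI cΦ' t ht)
    · exact (continuousOn_const.mul (slice (cD _) t ht)).mul (slice (cD _) t ht)
    · intro x hx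
      have hx' := Ioo_subset_Icc_self hx
      have n := Icc_mem_nhds hx.1 hx.2
      have h1 := (dx t ht x hx' (1, 0)).hasDerivAt n
      have h2 := ((dx t ht x hx' (0, 1)).hasDerivAt n).const_mul (2 * r)
      refine HasDerivAt.congr_deriv (h2.mul h1) ?_
      simp only [Φ']
      rw [hw t ht x hx', hsymm (t, x) ⟨ht.le, hx'⟩ (1, 0) (0, 1)]
      ring
  have hb : b ∈ Icc a b := ⟨hab.le, le_rfl⟩
  have ha : a ∈ Icc a b := ⟨le_rfl, hab.le⟩
  rw [e1 t ht b hb, e1 t ht a ha, e2 t ht b hb, e2 t ht a ha]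
  have key2 := key.congr_of_eventuallyEq (f₁ := fun t => ∫ x in a..b, ((deriv (fun s => u s x) t) ^ 2 +
      r * (derivWithin (fun y => u t y) (Icc a b) x) ^ 2)) (by
    filter_upwards [Ioi_mem_nhds ht] with s hs
    apply intervalIntegral.integral_congr
    intro x hx
    rw [uIcc_of_le hab.le] at hx
    simp only [Φ]
    rw [e1 s hs x hx, e2 s hs x hx])
  refine key2.congr_deriv ?_
  rw [hval]; ring

/-- dissipation law for the damped wave system on a chain of `N` strings:
for classical (C²) solutions satisfying `∂ₜ²u_j = ρ_j ∂ₓ²u_j`, the feedback condition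
`ρ₀ ∂ₓu₀(t,0) = ∂ₜu₀(t,0)`, the clamping `u_{N−1}(t,N) = 0`, continuity and flux conditions
at the interior nodes, the energy `E` satisfies `E'(t) = −|∂ₜu₀(t,0)|²` for every `t > 0`;
in particular `E` is nonincreasing on `(0, ∞)`. -/
theorem stmt8 (N : ℕ) (hN : 1 ≤ N) (ρ : ℕ → ℝ) (hρ : ∀ j < N, 0 < ρ j)
    (u : ℕ → ℝ → ℝ → ℝ)
    (hreg : ∀ j < N, ContDiffOn ℝ 2 (fun p : ℝ × ℝ => u j p.1 p.2)
      (Ici (0 : ℝ) ×ˢ Icc (j : ℝ) (j + 1)))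
    (hwave : ∀ j < N, ∀ t > (0 : ℝ), ∀ x ∈ Icc (j : ℝ) (j + 1),
      deriv (fun s => deriv (fun s' => u j s' x) s) t =
        ρ j * derivWithin (fun y => derivWithin (fun y' => u j t y') (Icc (j : ℝ) (j + 1)) y)
          (Icc (j : ℝ) (j + 1)) x)
    (hbc0 : ∀ t > (0 : ℝ),
      ρ 0 * derivWithin (fun y => u 0 t y) (Icc (0 : ℝ) 1) 0 = deriv (fun s => u 0 s 0) t)
    (hbcN : ∀ t > (0 : ℝ), u (N - 1) t N = 0)
    (hcont_node : ∀ t > (0 : ℝ), ∀ j, 1 ≤ j → j ≤ N - 1 → u (j - 1) t j = u j t j)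
    (hflux : ∀ t > (0 : ℝ), ∀ j, 1 ≤ j → j ≤ N - 1 →
      ρ (j - 1) * derivWithin (fun y => u (j - 1) t y)
          (Icc ((j - 1 : ℕ) : ℝ) ((j - 1 : ℕ) + 1)) j =
        ρ j * derivWithin (fun y => u j t y) (Icc (j : ℝ) (j + 1)) j) :
    (∀ t > (0 : ℝ), HasDerivAt (chainWaveEnergy N ρ u)
        (-(deriv (fun s => u 0 s 0) t) ^ 2) t) ∧
    (∀ t₁ t₂ : ℝ, 0 < t₁ → t₁ ≤ t₂ → chainWaveEnergy N ρ u t₂ ≤ chainWaveEnergy N ρ u t₁) := by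
  have hmain : ∀ t > (0 : ℝ), HasDerivAt (chainWaveEnergy N ρ u)
        (-(deriv (fun s => u 0 s 0) t) ^ 2) t := by
    intro t ht
    let f : ℕ → ℝ := fun j => if j < N then
      ρ j * derivWithin (fun y => u j t y) (Icc (j : ℝ) (j + 1)) j * deriv (fun s => u j s j) t
      else 0
    have hs : ∀ j ∈ Finset.range N, HasDerivAt (fun t => ∫ x in (j : ℝ)..(j + 1),
        ((deriv (fun s => u j s x) t) ^ 2 +
          ρ j * (derivWithin (fun y => u j t y) (Icc (j : ℝ) (j + 1)) x) ^ 2))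
        (2 * (f (j + 1) - f j)) t := by
      intro j hj
      have hj := Finset.mem_range.1 hj
      have h := string_energy (r := ρ j) (lt_add_one (j : ℝ)) (u j) (hreg j hj) (hwave j hj) ht
      refine h.congr_deriv ?_
      symm
      congr 2
      · by_cases hj1 : j + 1 < N
        · have hfl := hflux t ht (j + 1) (by omega) (by omega)
          have hd : deriv (fun s => u (j + 1) s ((j + 1 : ℕ) : ℝ)) t
              = deriv (fun s => u j s ((j + 1 : ℕ) : ℝ)) t := by
            apply Filter.EventuallyEq.deriv_eq
            filter_upwards [Ioi_mem_nhds ht] with s hs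
            exact (hcont_node s hs (j + 1) (by omega) (by omega)).symm
          simp only [f, if_pos hj1]
          rw [hd, ← hfl]
          simp
        · have hjN : N = j + 1 := by omega
          have hd : deriv (fun s => u j s ((j : ℝ) + 1)) t = 0 := by
            rw [← deriv_const t (0 : ℝ)]
            apply Filter.EventuallyEq.deriv_eq
            filter_upwards [Ioi_mem_nhds ht] with s hs
            have := hbcN s hs
            subst hjN
            simpa using this
          simp only [f, if_neg hj1, hd, mul_zero]
      · simp only [f, if_pos hj]
    have h := (HasDerivAt.fun_sum hs).const_mul (1 / 2 : ℝ)
    refine HasDerivAt.congr_deriv (f := chainWaveEnergy N ρ u) h ?_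
    rw [← Finset.mul_sum, Finset.sum_range_sub]
    have hb := hbc0 t ht
    have h0 : 0 < N := hN
    simp only [f, lt_irrefl, if_false, if_pos h0]
    simp only [Nat.cast_zero, zero_add]
    rw [hb]; ring
  refine ⟨hmain, fun t₁ t₂ h1 h12 => ?_⟩
  have hanti : AntitoneOn (chainWaveEnergy N ρ u) (Ioi 0) := by
    apply antitoneOn_of_deriv_nonpos (convex_Ioi 0)
    · exact fun t ht => (hmain t ht).continuousAt.continuousWithinAt
    · rw [interior_Ioi]
      exact fun t ht => (hmain t ht).differentiableAt.differentiableWithinAt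
    · rw [interior_Ioi]
      intro t ht
      rw [(hmain t ht).deriv]
      exact neg_nonpos.2 (sq_nonneg _)
  exact hanti h1 (lt_of_lt_of_le h1 h12) h12
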